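/- For all (r, θ) with Σ ≠ 0, sin θ ≠ 0, and r² + a² ≠ 0, the Newman–Penrose spin coefficient ρ of the Hartle–Hawking tetrad for the Kerr metric satisfies ρ = −Σ_{b,c} m^b m̄^c ∇_c ℓ_b = −Δ / (2(r² + a²)(r − i a cos θ)), where ∇_c ℓ_b = ∂_c (gℓ)_b − Σ_d Γ^d_{cb} (gℓ)_d with Γ the Levi-Civita connection coefficients of g. In particular, the expansion θ_exp = −(ρ + ρ̄) = Δ r / ((r²+a²)Σ) and the twist (proportional to ρ − ρ̄) both vanish at r = r₊ = M + √(M² − a²) when M > 0 and 0 ≤ a ≤ M. -/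

import Mathlib

open scoped BigOperators
open Matrix

/-- `Δ = r² − 2Mr + a²` for the Kerr metric. -/
noncomputable def kerrΔ (M a r : ℝ) : ℝ := r ^ 2 - 2 * M * r + a ^ 2

/-- `Σ = r² + a² cos²θ` for the Kerr metric. -/
noncomputable def kerrSigma (a r θ : ℝ) : ℝ := r ^ 2 + a ^ 2 * Real.cos θ ^ 2

/-- The Kerr metric in ingoing coordinates `(v, r, θ, φ)` (indices `0,1,2,3`),
determined by the line element
`ds² = −(1 − 2Mr/Σ)(dv − a sin²θ dφ)² + 2(dv − a sin²θ dφ)(dr − a sin²θ dφ)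
      + Σ(dθ² + sin²θ dφ²)`. -/
noncomputable def kerrMetric (M a r θ : ℝ) : Matrix (Fin 4) (Fin 4) ℝ :=
  fun i j =>
    let e1 : Fin 4 → ℝ := ![1, 0, 0, -a * Real.sin θ ^ 2]  -- dv − a sin²θ dφ
    let e2 : Fin 4 → ℝ := ![0, 1, 0, -a * Real.sin θ ^ 2]  -- dr − a sin²θ dφ
    let e3 : Fin 4 → ℝ := ![0, 0, 1, 0]                    -- dθ
    let e4 : Fin 4 → ℝ := ![0, 0, 0, 1]                    -- dφ
    (-(1 - 2 * M * r / kerrSigma a r θ) * e1 i * e1 j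
      + (e1 i * e2 j + e2 i * e1 j)
      + kerrSigma a r θ * e3 i * e3 j
      + kerrSigma a r θ * Real.sin θ ^ 2 * e4 i * e4 j)

/-- The `ℓ` vector of the Hartle–Hawking tetrad:
`ℓ = (1, Δ/(2(r²+a²)), 0, a/(r²+a²))`. -/
noncomputable def ellHH (M a r : ℝ) : Fin 4 → ℝ :=
  ![1, kerrΔ M a r / (2 * (r ^ 2 + a ^ 2)), 0, a / (r ^ 2 + a ^ 2)]

/-- The `n` vector of the Hartle–Hawking tetrad: `n = (0, −(r²+a²)/Σ, 0, 0)`. -/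
noncomputable def nHH (a r θ : ℝ) : Fin 4 → ℝ :=
  ![0, -(r ^ 2 + a ^ 2) / kerrSigma a r θ, 0, 0]

/-- The complex `m` vector of the Hartle–Hawking tetrad:
`m = (1/(√2 (r + i a cos θ))) (i a sin θ, 0, 1, i/sin θ)`. -/
noncomputable def mHH (a r θ : ℝ) : Fin 4 → ℂ :=
  fun i => (1 / (Real.sqrt 2 * ((r : ℂ) + Complex.I * (a : ℂ) * (Real.cos θ : ℂ)))) *
    ![Complex.I * (a : ℂ) * (Real.sin θ : ℂ), 0, 1, Complex.I / (Real.sin θ : ℂ)] i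

/-- Partial derivative of a scalar field on `ℝ⁴` in the `a`-th coordinate direction. -/
noncomputable def pderiv4 (f : (Fin 4 → ℝ) → ℝ) (x : Fin 4 → ℝ) (a : Fin 4) : ℝ :=
  fderiv ℝ f x (Pi.single a 1)

/-- Levi-Civita connection coefficients
`Γ^a_{bc} = (1/2) Σ_d g^{ad} (∂_b g_{dc} + ∂_c g_{bd} − ∂_d g_{bc})` of a metric
field on `ℝ⁴`, with `g⁻¹` the pointwise matrix inverse. -/
noncomputable def Christoffel (g : (Fin 4 → ℝ) → Matrix (Fin 4) (Fin 4) ℝ)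
    (x : Fin 4 → ℝ) (a b c : Fin 4) : ℝ :=
  (1 / 2) * ∑ d, (g x)⁻¹ a d *
    (pderiv4 (fun y => g y d c) x b + pderiv4 (fun y => g y b d) x c
      - pderiv4 (fun y => g y b c) x d)

/-- The Kerr metric as a field on `ℝ⁴` in ingoing coordinates `x = (v, r, θ, φ)`. -/
noncomputable def kerrField (M a : ℝ) (x : Fin 4 → ℝ) : Matrix (Fin 4) (Fin 4) ℝ :=
  kerrMetric M a (x 1) (x 2)

/-- The Hartle–Hawking vector `ℓ` as a field on `ℝ⁴`. -/
noncomputable def ellField (M a : ℝ) (x : Fin 4 → ℝ) : Fin 4 → ℝ :=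
  ellHH M a (x 1)


/-- Covariant derivative of the lowered Hartle–Hawking vector, `∇_c ℓ_b` with
`ℓ_b = (gℓ)_b`: `∇_c ℓ_b = ∂_c (gℓ)_b − Σ_d Γ^d_{cb} (gℓ)_d`. -/
noncomputable def covLowEll (M a : ℝ) (x : Fin 4 → ℝ) (c b : Fin 4) : ℝ :=
  pderiv4 (fun y => (kerrField M a y).mulVec (ellField M a y) b) x c
    - ∑ d, Christoffel (kerrField M a) x d c b *
        (kerrField M a x).mulVec (ellField M a x) d

/-- For a symmetric invertible metric, contracting the Christoffel symbols with a lowered vector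
removes the inverse metric. -/
theorem sum_christoffel_mul_mulVec {g : (Fin 4 → ℝ) → Matrix (Fin 4) (Fin 4) ℝ}
    {x : Fin 4 → ℝ} (hsymm : (g x).IsSymm) (hdet : IsUnit (g x).det) (L : Fin 4 → ℝ)
    (c b : Fin 4) :
    ∑ d, Christoffel g x d c b * (g x).mulVec L d =
      (1 / 2) * ∑ e, L e *
        (pderiv4 (fun y => g y e b) x c + pderiv4 (fun y => g y c e) x b
          - pderiv4 (fun y => g y c b) x e) := by
  set X : Fin 4 → ℝ := fun e => pderiv4 (fun y => g y e b) x c + pderiv4 (fun y => g y c e) x b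
    - pderiv4 (fun y => g y c b) x e with hX
  have hinv : (g x)⁻¹ᵀ = (g x)⁻¹ := by rw [transpose_nonsing_inv, hsymm.eq]
  have key : ((g x)⁻¹ *ᵥ X) ⬝ᵥ (g x *ᵥ L) = L ⬝ᵥ X := by
    rw [dotProduct_comm, dotProduct_mulVec, ← mulVec_transpose, mulVec_mulVec, hinv,
      nonsing_inv_mul _ hdet, one_mulVec]
  calc ∑ d, Christoffel g x d c b * (g x).mulVec L d
      = (1 / 2) * (((g x)⁻¹ *ᵥ X) ⬝ᵥ (g x *ᵥ L)) := by
        rw [dotProduct, Finset.mul_sum]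
        refine Finset.sum_congr rfl fun d _ => ?_
        simp only [Christoffel, mulVec, dotProduct, hX]
        ring
    _ = _ := by rw [key]; rfl

theorem pderiv4_eq_deriv_update {f : (Fin 4 → ℝ) → ℝ} {x : Fin 4 → ℝ}
    (hf : DifferentiableAt ℝ f x) (c : Fin 4) :
    pderiv4 f x c = deriv (fun t => f (Function.update x c t)) (x c) := by
  have h := hasDerivAt_update x c (x c)
  have hf' : HasFDerivAt f (fderiv ℝ f x) (Function.update x c (x c)) := by
    rw [Function.update_eq_self]; exact hf.hasFDerivAt
  exact (hf'.comp_hasDerivAt (x c) h).deriv.symm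

theorem kerrMetric_isSymm (M a r θ : ℝ) : (kerrMetric M a r θ).IsSymm := by
  ext i j
  simp only [kerrMetric, transpose_apply]
  ring

theorem det_kerrMetric (M a r θ : ℝ) :
    (kerrMetric M a r θ).det = -(kerrSigma a r θ * Real.sin θ) ^ 2 := by
  simp [kerrMetric, det_succ_row_zero, Fin.sum_univ_succ, Fin.succAbove]
  ring

theorem differentiableAt_kerrField {M a : ℝ} {x : Fin 4 → ℝ}
    (hSig : kerrSigma a (x 1) (x 2) ≠ 0) (i j : Fin 4) :
    DifferentiableAt ℝ (fun y => kerrField M a y i j) x := by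
  have hS : DifferentiableAt ℝ (fun y : Fin 4 → ℝ => kerrSigma a (y 1) (y 2)) x := by
    unfold kerrSigma
    fun_prop
  have hN : DifferentiableAt ℝ (fun y : Fin 4 → ℝ => 2 * M * y 1) x := by fun_prop
  have hF : DifferentiableAt ℝ
      (fun y : Fin 4 → ℝ => 2 * M * y 1 / kerrSigma a (y 1) (y 2)) x := hN.mul (hS.inv hSig)
  have hvec : ∀ v : ℝ → Fin 4 → ℝ, (∀ k, Differentiable ℝ fun t => v t k) → ∀ k,
    DifferentiableAt ℝ (fun y : Fin 4 → ℝ => v (y 2) k) x := fun v hv k =>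
      (hv k).differentiableAt.comp x (differentiableAt_apply (2 : Fin 4) x)
  have he1 := hvec (fun t => ![1, 0, 0, -a * Real.sin t ^ 2])
    (by intro k; fin_cases k <;> simp)
  have he2 := hvec (fun t => ![0, 1, 0, -a * Real.sin t ^ 2])
    (by intro k; fin_cases k <;> simp)
  have hs2 : DifferentiableAt ℝ (fun y : Fin 4 → ℝ => Real.sin (y 2) ^ 2) x := by fun_prop
  exact ((((((hF.const_sub 1).fun_neg.fun_mul (he1 i)).fun_mul (he1 j)).fun_add
    (((he1 i).fun_mul (he2 j)).fun_add ((he2 i).fun_mul (he1 j)))).fun_add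
    ((hS.mul_const _).mul_const _)).fun_add (((hS.fun_mul hs2).mul_const _).mul_const _))

/-- The derivative `∂_r (2Mr/Σ)`. -/
noncomputable def kerrPotentialDr (M a r θ : ℝ) : ℝ :=
  2 * M * (a ^ 2 * Real.cos θ ^ 2 - r ^ 2) / kerrSigma a r θ ^ 2

/-- The derivative `∂_θ (2Mr/Σ)`. -/
noncomputable def kerrPotentialDθ (M a r θ : ℝ) : ℝ :=
  4 * M * r * a ^ 2 * Real.cos θ * Real.sin θ / kerrSigma a r θ ^ 2

/-- The componentwise derivative `∂_r g` of the Kerr metric. -/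
noncomputable def kerrMetricDr (M a r θ : ℝ) : Matrix (Fin 4) (Fin 4) ℝ :=
  let w := -a * Real.sin θ ^ 2
  let U := kerrPotentialDr M a r θ
  !![U, 0, 0, U * w;
     0, 0, 0, 0;
     0, 0, 2 * r, 0;
     U * w, 0, 0, U * w ^ 2 + 2 * r * Real.sin θ ^ 2]

/-- The componentwise derivative `∂_θ g` of the Kerr metric. -/
noncomputable def kerrMetricDθ (M a r θ : ℝ) : Matrix (Fin 4) (Fin 4) ℝ :=
  let s := Real.sin θ
  let k := Real.cos θ
  let w := -a * s ^ 2
  let w' := -(2 * a * s * k)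
  let U := kerrPotentialDθ M a r θ
  let V := 2 * M * r / kerrSigma a r θ
  let S' := -(2 * a ^ 2 * k * s)
  !![U, 0, 0, U * w + V * w';
     0, 0, 0, w';
     0, 0, S', 0;
     U * w + V * w', w', 0,
       U * w ^ 2 + 2 * (1 + V) * w * w' + S' * s ^ 2 + 2 * kerrSigma a r θ * s * k]

theorem hasDerivAt_kerrMetric_r {M a r θ : ℝ} (hSig : kerrSigma a r θ ≠ 0) (i j : Fin 4) :
    HasDerivAt (fun t => kerrMetric M a t θ i j) (kerrMetricDr M a r θ i j) r := by
  have hS : HasDerivAt (fun t => kerrSigma a t θ) (2 * r) r := by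
    simpa [kerrSigma] using (hasDerivAt_pow 2 r).add_const (a ^ 2 * Real.cos θ ^ 2)
  have hF := (((hasDerivAt_id r).const_mul (2 * M)).fun_div hS hSig).const_sub 1 |>.fun_neg
  have hU : -(-((2 * M * 1 * kerrSigma a r θ - 2 * M * r * (2 * r)) / kerrSigma a r θ ^ 2))
      = kerrPotentialDr M a r θ := by
    simp only [kerrPotentialDr, kerrSigma]; ring
  simp only [id] at hF
  rw [hU] at hF
  unfold kerrMetric
  refine (((((hF.mul_const _).mul_const _).add_const _).add
    ((hS.mul_const _).mul_const _)).add (((hS.mul_const _).mul_const _).mul_const _)).congr_deriv ?_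
  fin_cases i <;> fin_cases j <;> simp [kerrMetricDr]
  ring

theorem hasDerivAt_kerrMetric_θ {M a r θ : ℝ} (hSig : kerrSigma a r θ ≠ 0) (i j : Fin 4) :
    HasDerivAt (fun t => kerrMetric M a r t i j) (kerrMetricDθ M a r θ i j) θ := by
  have hs2 : HasDerivAt (fun t => Real.sin t ^ 2) (2 * Real.sin θ * Real.cos θ) θ := by
    simpa using (Real.hasDerivAt_sin θ).fun_pow 2
  have hS : HasDerivAt (fun t => kerrSigma a r t) (-(2 * a ^ 2 * Real.cos θ * Real.sin θ)) θ := by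
    refine ((((Real.hasDerivAt_cos θ).fun_pow 2).const_mul (a ^ 2)).const_add
      (r ^ 2)).congr_deriv ?_
    simp; ring
  have hF := ((hasDerivAt_const θ (2 * M * r)).fun_div hS hSig).const_sub 1 |>.fun_neg
  have hU : -(-((0 * kerrSigma a r θ - 2 * M * r * -(2 * a ^ 2 * Real.cos θ * Real.sin θ)) /
      kerrSigma a r θ ^ 2)) = kerrPotentialDθ M a r θ := by
    simp only [kerrPotentialDθ]; ring
  rw [hU] at hF
  have hw := hs2.const_mul (-a)
  have he1 : ∀ k, HasDerivAt (fun t => (![1, 0, 0, -a * Real.sin t ^ 2] : Fin 4 → ℝ) k)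
      ((![0, 0, 0, -a * (2 * Real.sin θ * Real.cos θ)] : Fin 4 → ℝ) k) θ := by
    intro k
    fin_cases k
    exacts [hasDerivAt_const _ _, hasDerivAt_const _ _, hasDerivAt_const _ _, hw]
  have he2 : ∀ k, HasDerivAt (fun t => (![0, 1, 0, -a * Real.sin t ^ 2] : Fin 4 → ℝ) k)
      ((![0, 0, 0, -a * (2 * Real.sin θ * Real.cos θ)] : Fin 4 → ℝ) k) θ := by
    intro k
    fin_cases k
    exacts [hasDerivAt_const _ _, hasDerivAt_const _ _, hasDerivAt_const _ _, hw]
  unfold kerrMetric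
  refine (((((hF.fun_mul (he1 i)).fun_mul (he1 j)).add
    (((he1 i).fun_mul (he2 j)).add ((he2 i).fun_mul (he1 j)))).add
    ((hS.mul_const _).mul_const _)).add
    (((hS.fun_mul hs2).mul_const _).mul_const _)).congr_deriv ?_
  fin_cases i <;> fin_cases j <;> simp [kerrMetricDθ] <;> ring

theorem pderiv4_kerrField {M a : ℝ} {x : Fin 4 → ℝ} (hSig : kerrSigma a (x 1) (x 2) ≠ 0)
    (i j c : Fin 4) :
    pderiv4 (fun y => kerrField M a y i j) x c =
      ![0, kerrMetricDr M a (x 1) (x 2) i j, kerrMetricDθ M a (x 1) (x 2) i j, 0] c := by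
  rw [pderiv4_eq_deriv_update (differentiableAt_kerrField hSig i j)]
  fin_cases c
  · simp [kerrField]
  · simpa [kerrField] using (hasDerivAt_kerrMetric_r hSig i j).deriv
  · simpa [kerrField] using (hasDerivAt_kerrMetric_θ hSig i j).deriv
  · simp [kerrField]

theorem differentiableAt_ellField {M a : ℝ} {x : Fin 4 → ℝ} (hra : x 1 ^ 2 + a ^ 2 ≠ 0)
    (j : Fin 4) : DifferentiableAt ℝ (fun y => ellField M a y j) x := by
  have h2 : 2 * (x 1 ^ 2 + a ^ 2) ≠ 0 := mul_ne_zero two_ne_zero hra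
  unfold ellField ellHH kerrΔ
  fin_cases j <;> simp <;> fun_prop (disch := assumption)

theorem pderiv4_ellField_eq_zero {M a : ℝ} {x : Fin 4 → ℝ} (hra : x 1 ^ 2 + a ^ 2 ≠ 0)
    (j : Fin 4) {c : Fin 4} (hc : c ≠ 1) : pderiv4 (fun y => ellField M a y j) x c = 0 := by
  rw [pderiv4_eq_deriv_update (differentiableAt_ellField hra j)]
  simp [ellField, Function.update_of_ne hc.symm]

/-- Away from the radial direction, `∇_c ℓ_b` involves only derivatives of the metric. -/
theorem covLowEll_eq {M a : ℝ} {x : Fin 4 → ℝ} (hSig : kerrSigma a (x 1) (x 2) ≠ 0)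
    (hs : Real.sin (x 2) ≠ 0) (hra : x 1 ^ 2 + a ^ 2 ≠ 0) {c : Fin 4} (hc : c ≠ 1) (b : Fin 4) :
    covLowEll M a x c b = (1 / 2) * ∑ e, ellField M a x e *
      (pderiv4 (fun y => kerrField M a y b e) x c - pderiv4 (fun y => kerrField M a y c e) x b
        + pderiv4 (fun y => kerrField M a y c b) x e) := by
  have hdet : IsUnit (kerrField M a x).det := by
    rw [isUnit_iff_ne_zero, kerrField, det_kerrMetric]
    exact neg_ne_zero.mpr (pow_ne_zero 2 (mul_ne_zero hSig hs))
  have hprod : pderiv4 (fun y => (kerrField M a y).mulVec (ellField M a y) b) x c =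
      ∑ e, ellField M a x e * pderiv4 (fun y => kerrField M a y b e) x c := by
    have h := HasFDerivAt.fun_sum (u := Finset.univ) fun e (_ : e ∈ Finset.univ) =>
      (differentiableAt_kerrField (M := M) hSig b e).hasFDerivAt.fun_mul
        (differentiableAt_ellField (M := M) hra e).hasFDerivAt
    have h' : HasFDerivAt (fun y => (kerrField M a y).mulVec (ellField M a y) b) _ x := h
    rw [pderiv4, h'.fderiv, _root_.sum_apply]
    refine Finset.sum_congr rfl fun e _ => ?_
    have h0 : fderiv ℝ (fun y => ellField M a y e) x (Pi.single c 1) = 0 :=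
      pderiv4_ellField_eq_zero hra e hc
    simp [pderiv4, h0]
  have hsymm : ∀ e, (fun y => kerrField M a y e b) = fun y => kerrField M a y b e := fun e =>
    funext fun y => (kerrMetric_isSymm M a (y 1) (y 2)).apply b e
  rw [covLowEll, hprod,
    sum_christoffel_mul_mulVec (kerrMetric_isSymm M a (x 1) (x 2)) hdet, Finset.mul_sum,
    Finset.mul_sum, ← Finset.sum_sub_distrib]
  refine Finset.sum_congr rfl fun e _ => ?_
  rw [hsymm e]
  ring

/-- A real matrix contracted with `m` and `m̄`, split into real and imaginary parts. -/
theorem sum_mHH_mul_conj_mHH {a r θ : ℝ} (hs : Real.sin θ ≠ 0) (T : Fin 4 → Fin 4 → ℝ) :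
    ∑ b, ∑ c, mHH a r θ b * (starRingEnd ℂ) (mHH a r θ c) * (T c b : ℂ) =
      1 / (2 * (kerrSigma a r θ : ℂ)) *
        (((a ^ 2 * Real.sin θ ^ 2 * T 0 0 + T 2 2 + T 3 3 / Real.sin θ ^ 2
            + a * (T 0 3 + T 3 0) : ℝ) : ℂ) +
          Complex.I * ((a * Real.sin θ * (T 2 0 - T 0 2)
            + (T 2 3 - T 3 2) / Real.sin θ : ℝ) : ℂ)) := by
  have hs' : (Real.sin θ : ℂ) ≠ 0 := by exact_mod_cast hs
  set N : ℂ := 1 / (Real.sqrt 2 * ((r : ℂ) + Complex.I * (a : ℂ) * (Real.cos θ : ℂ))) with hN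
  have hNN : N * (starRingEnd ℂ) N = 1 / (2 * (kerrSigma a r θ : ℂ)) := by
    have h2 : (Real.sqrt 2 : ℂ) * Real.sqrt 2 = 2 := by
      exact_mod_cast Real.mul_self_sqrt zero_le_two
    have hden : (2 * kerrSigma a r θ : ℂ) =
        (Real.sqrt 2 * ((r : ℂ) + Complex.I * a * Real.cos θ)) *
          (Real.sqrt 2 * ((r : ℂ) + -Complex.I * a * Real.cos θ)) := by
      simp only [kerrSigma]
      push_cast
      linear_combination (-(r : ℂ) ^ 2 + Complex.I ^ 2 * a ^ 2 * Complex.cos θ ^ 2) * h2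
        + 2 * a ^ 2 * Complex.cos θ ^ 2 * Complex.I_sq
    rw [hden, hN]
    simp only [map_div₀, map_mul, map_add, map_one, Complex.conj_ofReal, Complex.conj_I]
    rw [div_mul_div_comm, one_mul]
  rw [← hNN]
  simp only [mHH, ← hN, Fin.sum_univ_four, map_mul]
  simp [-Complex.ofReal_sin]
  field_simp
  ring_nf
  simp only [Complex.I_sq]
  ring

/-- The spin coefficient `ρ` of the Hartle–Hawking tetrad as a real multiple of `r + i a cos θ`. -/
theorem ellHH_rho {M a : ℝ} {x : Fin 4 → ℝ}
    (hSig : kerrSigma a (x 1) (x 2) ≠ 0) (hs : Real.sin (x 2) ≠ 0)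
    (hra : (x 1) ^ 2 + a ^ 2 ≠ 0) :
    -∑ b, ∑ c, mHH a (x 1) (x 2) b * (starRingEnd ℂ) (mHH a (x 1) (x 2) c) *
      (covLowEll M a x c b : ℂ) =
    -((kerrΔ M a (x 1) / (2 * (x 1 ^ 2 + a ^ 2) * kerrSigma a (x 1) (x 2)) : ℝ) : ℂ) *
      ((x 1 : ℂ) + Complex.I * a * Real.cos (x 2)) := by
  have hT : ∀ c b, c ≠ 1 → covLowEll M a x c b = _ := fun c b hc => covLowEll_eq hSig hs hra hc b
  have hcos : Real.cos (x 2) ^ 2 = 1 - Real.sin (x 2) ^ 2 := Real.cos_sq' _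
  have hre : a ^ 2 * Real.sin (x 2) ^ 2 * covLowEll M a x 0 0 + covLowEll M a x 2 2
      + covLowEll M a x 3 3 / Real.sin (x 2) ^ 2
      + a * (covLowEll M a x 0 3 + covLowEll M a x 3 0) =
      kerrΔ M a (x 1) * x 1 / (x 1 ^ 2 + a ^ 2) := by
    rw [hT 0 0 (by decide), hT 2 2 (by decide), hT 3 3 (by decide), hT 0 3 (by decide),
      hT 3 0 (by decide)]
    simp [pderiv4_kerrField hSig, Fin.sum_univ_four, ellField, ellHH, kerrMetricDr, kerrMetricDθ]
    field_simp
    ring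
  have him : a * Real.sin (x 2) * (covLowEll M a x 2 0 - covLowEll M a x 0 2)
      + (covLowEll M a x 2 3 - covLowEll M a x 3 2) / Real.sin (x 2) =
      kerrΔ M a (x 1) * (a * Real.cos (x 2)) / (x 1 ^ 2 + a ^ 2) := by
    rw [hT 2 0 (by decide), hT 0 2 (by decide), hT 2 3 (by decide), hT 3 2 (by decide)]
    simp [pderiv4_kerrField hSig, Fin.sum_univ_four, ellField, ellHH, kerrMetricDr, kerrMetricDθ,
      kerrPotentialDθ]
    field_simp
    simp only [kerrSigma, kerrΔ, hcos]
    ring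
  rw [sum_mHH_mul_conj_mHH hs, hre, him]
  have hSig' : (kerrSigma a (x 1) (x 2) : ℂ) ≠ 0 := by exact_mod_cast hSig
  have hra' : (x 1 : ℂ) ^ 2 + (a : ℂ) ^ 2 ≠ 0 := by exact_mod_cast hra
  push_cast
  field_simp

/-- Wherever `Σ ≠ 0`, `sin θ ≠ 0`, and `r² + a² ≠ 0`, the
Newman–Penrose spin coefficient `ρ` of the Hartle–Hawking tetrad for the Kerr metric
satisfies `ρ = −Σ_{b,c} m^b m̄^c ∇_c ℓ_b = −Δ/(2(r²+a²)(r − i a cos θ))`.  In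
particular the expansion `θ_exp = −(ρ + ρ̄) = Δ r/((r²+a²)Σ)` and the twist
(proportional to `ρ − ρ̄`) both vanish at `r = r₊ = M + √(M² − a²)` when `M > 0` and
`0 ≤ a ≤ M`. -/
theorem ellHH_rho_expansion_twist (M a : ℝ) (x : Fin 4 → ℝ)
    (hSig : kerrSigma a (x 1) (x 2) ≠ 0) (hs : Real.sin (x 2) ≠ 0)
    (hra : (x 1) ^ 2 + a ^ 2 ≠ 0) :
    let r : ℝ := x 1
    let θ : ℝ := x 2
    let ρ : ℂ := -∑ b, ∑ c, mHH a r θ b * (starRingEnd ℂ) (mHH a r θ c) *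
      (covLowEll M a x c b : ℂ)
    (ρ = -(kerrΔ M a r : ℂ) /
        (2 * ((r ^ 2 + a ^ 2 : ℝ) : ℂ) * ((r : ℂ) - Complex.I * a * Real.cos θ))) ∧
    (-(ρ + (starRingEnd ℂ) ρ)
        = ((kerrΔ M a r * r / ((r ^ 2 + a ^ 2) * kerrSigma a r θ) : ℝ) : ℂ)) ∧
    (0 < M → 0 ≤ a → a ≤ M → r = M + Real.sqrt (M ^ 2 - a ^ 2) →
      -(ρ + (starRingEnd ℂ) ρ) = 0 ∧ ρ - (starRingEnd ℂ) ρ = 0) := by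
  intro r θ ρ
  have hρ : ρ = -((kerrΔ M a r / (2 * (r ^ 2 + a ^ 2) * kerrSigma a r θ) : ℝ) : ℂ) *
      ((r : ℂ) + Complex.I * a * Real.cos θ) := ellHH_rho hSig hs hra
  have hSig' : (kerrSigma a r θ : ℂ) ≠ 0 := by exact_mod_cast hSig
  have hra' : (r : ℂ) ^ 2 + (a : ℂ) ^ 2 ≠ 0 := by exact_mod_cast hra
  have hfac : (kerrSigma a r θ : ℂ) =
      (r + Complex.I * a * Real.cos θ) * (r - Complex.I * a * Real.cos θ) := by
    simp only [kerrSigma]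
    push_cast
    linear_combination a ^ 2 * Complex.cos θ ^ 2 * Complex.I_sq
  have hconj : (starRingEnd ℂ) ρ =
      -((kerrΔ M a r / (2 * (r ^ 2 + a ^ 2) * kerrSigma a r θ) : ℝ) : ℂ) *
      ((r : ℂ) - Complex.I * a * Real.cos θ) := by
    rw [hρ]
    simp only [map_mul, map_neg, map_add, Complex.conj_ofReal, Complex.conj_I]
    ring
  refine ⟨?_, ?_, fun hM ha haM hr => ?_⟩
  · rw [hρ]
    have hne := hfac ▸ hSig'
    have h1 := left_ne_zero_of_mul hne
    have h2 := right_ne_zero_of_mul hne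
    push_cast [hfac] at h1 h2 ⊢
    rw [mul_comm Complex.I (a : ℂ)] at h1 h2 ⊢
    field_simp
  · rw [hconj, hρ]
    push_cast
    field_simp
    ring
  · have hΔ : kerrΔ M a r = 0 := by
      have hsq : Real.sqrt (M ^ 2 - a ^ 2) ^ 2 = M ^ 2 - a ^ 2 := Real.sq_sqrt (by nlinarith)
      rw [kerrΔ, hr]
      linear_combination hsq
    have h0 : ρ = 0 := by rw [hρ, hΔ]; simp
    simp [h0]
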